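/- arXiv:2401.14669 — 2 statements merged into one kernel-verified Lean document; each statement's English description precedes it below -/
import Mathlib

section
/- Fix 0 ≤ t < n and observations y_0 ∈ Y_0, …, y_{t+1} ∈ Y_{t+1}, and suppose p^Y_{[t]}(y_0, …, y_t) > 0. Let B_t be the instantiated Bayes filter for the observations y_0, …, y_t. Then p^Y_{[t+1]}(y_0, …, y_{t+1}) = p^Y_{[t]}(y_0, …, y_t) · Σ_{x ∈ X_t} Σ_{x' ∈ X_{t+1}} g_{t+1}(y_{t+1} | x') · f_{t+1}(x' | x) · B_t(x); that is, the joint probability of the observation sequence can be extended one step using the Bayes filter. -/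
open scoped ENNReal Classical

namespace DiscreteHMM

variable {n : ℕ}

/-- The joint distribution of a discrete hidden Markov model with initial distribution
`f₀`, transition kernels `f` and observation kernels `g`. -/
noncomputable def hmmJoint {X Y : Fin (n+1) → Type*}
    (f₀ : PMF (X 0)) (f : ∀ t : Fin n, X t.castSucc → PMF (X t.succ))
    (g : ∀ t : Fin (n+1), X t → PMF (Y t)) (ω : ∀ t, X t × Y t) : ℝ≥0∞ :=
  f₀ (ω 0).1 * g 0 (ω 0).1 (ω 0).2 *
    ∏ t : Fin n, (f t (ω t.castSucc).1 (ω t.succ).1 * g t.succ (ω t.succ).1 (ω t.succ).2)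

/-- Probability of the event `E` under the probability mass function `p` on a finite
type. -/
noncomputable def prob {Ω : Type*} [Fintype Ω] (p : Ω → ℝ≥0∞) (E : Set Ω) : ℝ≥0∞ :=
  ∑ ω, E.indicator p ω

variable {X Y : Fin (n+1) → Type*} [∀ i, Fintype (X i)] [∀ i, Fintype (Y i)]
  [∀ i, Nonempty (X i)] [∀ i, Nonempty (Y i)]

/-- The instantiated Bayes filter `B_t` for the observation sequence `y`, computed by the
recursion `B_t(x) = g_t(y_t|x) · q_t(x) / (Σ_{x'} g_t(y_t|x') · q_t(x'))` where
`q_0 = f₀` and `q_t(x) = Σ_{x'} f_t(x|x') · B_{t-1}(x')`. -/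
noncomputable def bayesFilter (f₀ : PMF (X 0))
    (f : ∀ t : Fin n, X t.castSucc → PMF (X t.succ))
    (g : ∀ t : Fin (n+1), X t → PMF (Y t)) (y : ∀ t, Y t) :
    ∀ t : Fin (n+1), X t → ℝ≥0∞ :=
  Fin.induction
    (fun x => g 0 x (y 0) * f₀ x / ∑ x', g 0 x' (y 0) * f₀ x')
    (fun i ih x =>
      g i.succ x (y i.succ) * (∑ x', f i x' x * ih x') /
        ∑ x'', g i.succ x'' (y i.succ) * ∑ x', f i x' x'' * ih x')

/-- The predicted ("prediction step") distribution `q_t` of the instantiated Bayes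
filter: `q_0 = f₀` and `q_t(x) = Σ_{x'} f_t(x|x') · B_{t-1}(x')`. -/
noncomputable def bayesPredict (f₀ : PMF (X 0))
    (f : ∀ t : Fin n, X t.castSucc → PMF (X t.succ))
    (g : ∀ t : Fin (n+1), X t → PMF (Y t)) (y : ∀ t, Y t) :
    ∀ t : Fin (n+1), X t → ℝ≥0∞ :=
  Fin.cases (fun x => f₀ x)
    (fun i x => ∑ x', f i x' x * bayesFilter f₀ f g y i.castSucc x')

/-- The total weight of the paths of an inhomogeneous chain that end in a given state at a given
time, for an initial weight `a` and transition weights `w`. -/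
def forwardWeight {R : Type*} [CommSemiring R] {m : ℕ} {Z : Fin (m+1) → Type*}
    [∀ i, Fintype (Z i)] (a : Z 0 → R) (w : ∀ i : Fin m, Z i.castSucc → Z i.succ → R) :
    ∀ i : Fin (m+1), Z i → R :=
  Fin.induction a (fun i ih z' => ∑ z, ih z * w i z z')

section ForwardWeight

variable {R : Type*} [CommSemiring R] {m : ℕ}

lemma forwardWeight_zero {Z : Fin (m+1) → Type*}
    [∀ i, Fintype (Z i)] (a : Z 0 → R) (w : ∀ i : Fin m, Z i.castSucc → Z i.succ → R) :
    forwardWeight a w 0 = a := rfl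

lemma forwardWeight_succ {Z : Fin (m+1) → Type*}
    [∀ i, Fintype (Z i)] (a : Z 0 → R) (w : ∀ i : Fin m, Z i.castSucc → Z i.succ → R)
    (i : Fin m) (z' : Z i.succ) :
    forwardWeight a w i.succ z' = ∑ z, forwardWeight a w i.castSucc z * w i z z' := rfl

/-- Restarting the chain after its first step. -/
lemma forwardWeight_tail {Z : Fin (m+1+1) → Type*}
    [∀ i, Fintype (Z i)] (a : Z 0 → R) (w : ∀ i : Fin (m+1), Z i.castSucc → Z i.succ → R)
    (i : Fin (m+1)) :
    forwardWeight (Z := fun j => Z j.succ) (fun z' : Z (Fin.succ 0) => ∑ z, a z * w 0 z z')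
      (fun j z z' => w j.succ z z') i = forwardWeight a w i.succ := by
  induction i using Fin.induction with
  | zero => rfl
  | succ i ih =>
    funext z'
    rw [forwardWeight_succ, ih]
    rfl

/-- The total weight of all paths is the total forward weight at the final time. -/
lemma sum_path_weight {Z : Fin (m+1) → Type*}
    [∀ i, Fintype (Z i)] (a : Z 0 → R) (w : ∀ i : Fin m, Z i.castSucc → Z i.succ → R) :
    ∑ ω : ∀ i, Z i, a (ω 0) * ∏ i, w i (ω i.castSucc) (ω i.succ) =
      ∑ z, forwardWeight a w (Fin.last m) z := by
  induction m with
  | zero =>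
    rw [← (Equiv.piUnique (α := Fin 1) Z).symm.sum_comp]
    simp only [Finset.univ_eq_empty, Finset.prod_empty, mul_one]
    rfl
  | succ m ih =>
    have h := ih (Z := fun j => Z j.succ)
      (fun z' : Z (Fin.succ 0) => ∑ z, a z * w 0 z z') (fun j z z' => w j.succ z z')
    rw [forwardWeight_tail] at h
    rw [← Fin.succ_last, ← h, ← (Fin.consEquiv Z).sum_comp, Fintype.sum_prod_type_right]
    refine Finset.sum_congr rfl fun ω _ => ?_
    rw [Finset.sum_mul]
    refine Finset.sum_congr rfl fun z _ => ?_
    rw [Fin.prod_univ_succ, ← mul_assoc]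
    rfl

/-- If the transition weights are stochastic from time `t` on, the total weight of all paths is
the total forward weight at time `t`. -/
lemma sum_forwardWeight_last {Z : Fin (m+1) → Type*}
    [∀ i, Fintype (Z i)] (a : Z 0 → R) (w : ∀ i : Fin m, Z i.castSucc → Z i.succ → R)
    (t : Fin (m+1)) (hw : ∀ i : Fin m, t ≤ i.castSucc → ∀ z, ∑ z', w i z z' = 1) :
    ∑ z, forwardWeight a w (Fin.last m) z = ∑ z, forwardWeight a w t z := by
  induction t using Fin.reverseInduction with
  | last => rfl
  | cast i ih =>
    rw [ih fun j hj => hw j (i.castSucc_lt_succ.le.trans hj)]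
    simp_rw [forwardWeight_succ]
    rw [Finset.sum_comm]
    simp_rw [← Finset.mul_sum, hw i le_rfl, mul_one]

end ForwardWeight

lemma sum_pmf_apply {α : Type*} [Fintype α] (p : PMF α) : ∑ b, p b = 1 := by
  rw [← tsum_fintype (L := .unconditional α), p.tsum_coe]

/-- The joint probability of the observations up to time `t` and the hidden state at time `t`,
given by the forward recursion. -/
noncomputable def jointFilter (f₀ : PMF (X 0))
    (f : ∀ t : Fin n, X t.castSucc → PMF (X t.succ))
    (g : ∀ t : Fin (n+1), X t → PMF (Y t)) (y : ∀ t, Y t) :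
    ∀ t : Fin (n+1), X t → ℝ≥0∞ :=
  Fin.induction (fun x => g 0 x (y 0) * f₀ x)
    (fun i ih x => g i.succ x (y i.succ) * ∑ x', f i x' x * ih x')

lemma jointFilter_succ
    {X Y : Fin (n+1) → Type*} [∀ i, Fintype (X i)]
    (f₀ : PMF (X 0)) (f : ∀ t : Fin n, X t.castSucc → PMF (X t.succ))
    (g : ∀ t : Fin (n+1), X t → PMF (Y t)) (y : ∀ t, Y t) (i : Fin n) (x : X i.succ) :
    jointFilter f₀ f g y i.succ x =
      g i.succ x (y i.succ) * ∑ x', f i x' x * jointFilter f₀ f g y i.castSucc x' := rfl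

lemma bayesFilter_succ
    {X Y : Fin (n+1) → Type*} [∀ i, Fintype (X i)]
    (f₀ : PMF (X 0)) (f : ∀ t : Fin n, X t.castSucc → PMF (X t.succ))
    (g : ∀ t : Fin (n+1), X t → PMF (Y t)) (y : ∀ t, Y t) (i : Fin n) (x : X i.succ) :
    bayesFilter f₀ f g y i.succ x =
      g i.succ x (y i.succ) * (∑ x', f i x' x * bayesFilter f₀ f g y i.castSucc x') /
        ∑ x'', g i.succ x'' (y i.succ) *
          ∑ x', f i x' x'' * bayesFilter f₀ f g y i.castSucc x' := rfl

lemma jointFilter_ne_top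
    {X Y : Fin (n+1) → Type*} [∀ i, Fintype (X i)]
    (f₀ : PMF (X 0)) (f : ∀ t : Fin n, X t.castSucc → PMF (X t.succ))
    (g : ∀ t : Fin (n+1), X t → PMF (Y t)) (y : ∀ t, Y t) (t : Fin (n+1)) (x : X t) :
    jointFilter f₀ f g y t x ≠ ∞ := by
  induction t using Fin.induction with
  | zero => exact ENNReal.mul_ne_top (PMF.apply_ne_top _ _) (PMF.apply_ne_top _ _)
  | succ i ih =>
    rw [jointFilter_succ]
    exact ENNReal.mul_ne_top (PMF.apply_ne_top _ _) (ENNReal.sum_ne_top.2 fun x' _ =>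
      ENNReal.mul_ne_top (PMF.apply_ne_top _ _) (ih x'))

/-- The Bayes filter is the normalization of the joint filter. -/
lemma jointFilter_eq_sum_mul_bayesFilter
    {X Y : Fin (n+1) → Type*} [∀ i, Fintype (X i)]
    (f₀ : PMF (X 0))
    (f : ∀ t : Fin n, X t.castSucc → PMF (X t.succ))
    (g : ∀ t : Fin (n+1), X t → PMF (Y t)) (y : ∀ t, Y t) (t : Fin (n+1)) (x : X t) :
    jointFilter f₀ f g y t x =
      (∑ x', jointFilter f₀ f g y t x') * bayesFilter f₀ f g y t x := by
  have sum_mul_div {ι : Type _} [Fintype ι] (c : ℝ≥0∞) (N : ι → ℝ≥0∞) (j : ι)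
      (hfin : ∑ k, c * N k ≠ ∞) : c * N j = (∑ k, c * N k) * (N j / ∑ k, N k) := by
    rw [← Finset.mul_sum] at hfin ⊢
    rcases eq_or_ne c 0 with rfl | hc
    · simp
    · rw [mul_assoc, ENNReal.mul_div_cancel']
      · exact fun h => (Finset.sum_eq_zero_iff.1 h) j (Finset.mem_univ j)
      · intro h
        rw [h, ENNReal.mul_top hc] at hfin
        exact absurd rfl hfin
  have hfin (s : Fin (n+1)) : ∑ x', jointFilter f₀ f g y s x' ≠ ∞ :=
    ENNReal.sum_ne_top.2 fun x' _ => jointFilter_ne_top f₀ f g y s x'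
  induction t using Fin.induction with
  | zero =>
    have h := sum_mul_div 1 (fun x => g 0 x (y 0) * f₀ x) x
    simp only [one_mul] at h
    exact h (hfin 0)
  | succ i ih =>
    have hstep (x : X i.succ) : jointFilter f₀ f g y i.succ x =
        (∑ x', jointFilter f₀ f g y i.castSucc x') *
          (g i.succ x (y i.succ) * ∑ x', f i x' x * bayesFilter f₀ f g y i.castSucc x') := by
      rw [jointFilter_succ, mul_left_comm, Finset.mul_sum (Finset.univ : Finset (X i.castSucc))
        (fun x' => f i x' x * bayesFilter f₀ f g y i.castSucc x')]
      congr 1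
      refine Finset.sum_congr rfl fun x' _ => ?_
      rw [ih x', mul_left_comm]
    have hf := hfin i.succ
    simp only [hstep] at hf ⊢
    rw [bayesFilter_succ]
    exact sum_mul_div _ _ x hf

/-- The probability of the observations up to time `t` is the total mass of the joint filter. -/
lemma probObs_eq_sum_jointFilter
    {X Y : Fin (n+1) → Type*} [∀ i, Fintype (X i)] [∀ i, Fintype (Y i)]
    (f₀ : PMF (X 0))
    (f : ∀ t : Fin n, X t.castSucc → PMF (X t.succ))
    (g : ∀ t : Fin (n+1), X t → PMF (Y t)) (y : ∀ t, Y t) (t : Fin (n+1)) :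
    prob (hmmJoint f₀ f g) {ω | ∀ i : Fin (n+1), i ≤ t → (ω i).2 = y i} =
      ∑ x, jointFilter f₀ f g y t x := by
  let e : ∀ i : Fin (n+1), X i × Y i → ℝ≥0∞ := fun i z => if i ≤ t → z.2 = y i then 1 else 0
  let a : X 0 × Y 0 → ℝ≥0∞ := fun z => f₀ z.1 * g 0 z.1 z.2 * e 0 z
  let w : ∀ i : Fin n, X i.castSucc × Y i.castSucc → X i.succ × Y i.succ → ℝ≥0∞ :=
    fun i z z' => f i z.1 z'.1 * g i.succ z'.1 z'.2 * e i.succ z'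
  have hpath : prob (hmmJoint f₀ f g) {ω | ∀ i : Fin (n+1), i ≤ t → (ω i).2 = y i} =
      ∑ ω : ∀ i, X i × Y i, a (ω 0) * ∏ i, w i (ω i.castSucc) (ω i.succ) := by
    refine Finset.sum_congr rfl fun ω _ => ?_
    have he : ∏ i, e i (ω i) =
        if ∀ i : Fin (n+1), i ≤ t → (ω i).2 = y i then 1 else 0 := by
      simp [e, Finset.prod_ite_zero]
    rw [Fin.prod_univ_succ] at he
    simp only [a, w, Finset.prod_mul_distrib (f := fun i : Fin n =>
      f i (ω i.castSucc).1 (ω i.succ).1 * g i.succ (ω i.succ).1 (ω i.succ).2)]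
    rw [mul_mul_mul_comm, he, Set.indicator_apply, mul_ite, mul_one, mul_zero]
    rfl
  rw [hpath, sum_path_weight (Z := fun i => X i × Y i) a w,
    sum_forwardWeight_last (Z := fun i => X i × Y i) a w t]
  · have key : ∀ i : Fin (n+1), i ≤ t → ∀ z, forwardWeight (Z := fun i => X i × Y i) a w i z =
        if z.2 = y i then jointFilter f₀ f g y i z.1 else 0 := by
      intro i
      induction i using Fin.induction with
      | zero =>
        rintro - ⟨x, b⟩
        by_cases hb : b = y 0
        · subst hb
          simp [forwardWeight_zero, a, e, jointFilter, mul_comm]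
        · simp [forwardWeight_zero, a, e, hb]
      | succ i ih =>
        rintro hi ⟨x, b⟩
        rw [forwardWeight_succ]
        simp only [ih (i.castSucc_lt_succ.le.trans hi), Fintype.sum_prod_type, ite_mul, zero_mul,
          w, e, hi, true_imp_iff]
        by_cases hb : b = y i.succ
        · subst hb
          simp only [Finset.sum_ite_eq', Finset.mem_univ, if_true, jointFilter_succ, mul_one,
            Finset.mul_sum]
          exact Finset.sum_congr rfl fun x' _ => by ring
        · simp [hb]
    simp only [key t le_rfl, Fintype.sum_prod_type, Finset.sum_ite_eq', Finset.mem_univ, if_true]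
  · rintro i hi ⟨x, b⟩
    have hlt : ¬ i.succ ≤ t := not_le.2 (hi.trans_lt i.castSucc_lt_succ)
    simp only [w, e, hlt, false_imp_iff, if_true, mul_one, Fintype.sum_prod_type,
      ← Finset.mul_sum, sum_pmf_apply]

/-- **One-step extension of the observation-sequence probability via the Bayes filter**:
`p^Y_{[t+1]}(y_0,…,y_{t+1}) = p^Y_{[t]}(y_0,…,y_t) ·
Σ_x Σ_{x'} g_{t+1}(y_{t+1}|x') · f_{t+1}(x'|x) · B_t(x)`. -/
theorem probObs_succ_eq
    (f₀ : PMF (X 0)) (f : ∀ t : Fin n, X t.castSucc → PMF (X t.succ))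
    (g : ∀ t : Fin (n+1), X t → PMF (Y t)) (y : ∀ t, Y t)
    (t : ℕ) (ht : t + 1 ≤ n)
    (hpos : 0 < prob (hmmJoint f₀ f g)
      {ω | ∀ i : Fin (n+1), (i : ℕ) ≤ t → (ω i).2 = y i}) :
    prob (hmmJoint f₀ f g) {ω | ∀ i : Fin (n+1), (i : ℕ) ≤ t + 1 → (ω i).2 = y i} =
      prob (hmmJoint f₀ f g) {ω | ∀ i : Fin (n+1), (i : ℕ) ≤ t → (ω i).2 = y i} *
        ∑ x : X ⟨t, by omega⟩, ∑ x' : X ⟨t + 1, by omega⟩,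
          g ⟨t + 1, by omega⟩ x' (y ⟨t + 1, by omega⟩) * f ⟨t, by omega⟩ x x' *
            bayesFilter f₀ f g y ⟨t, by omega⟩ x := by
  let i : Fin n := ⟨t, ht⟩
  have hcast : prob (hmmJoint f₀ f g) {ω | ∀ j : Fin (n+1), (j : ℕ) ≤ t → (ω j).2 = y j} =
      ∑ x, jointFilter f₀ f g y i.castSucc x := probObs_eq_sum_jointFilter f₀ f g y i.castSucc
  have hsucc : prob (hmmJoint f₀ f g) {ω | ∀ j : Fin (n+1), (j : ℕ) ≤ t + 1 → (ω j).2 = y j} =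
      ∑ x, jointFilter f₀ f g y i.succ x := probObs_eq_sum_jointFilter f₀ f g y i.succ
  rw [hcast, hsucc]
  change _ = _ * ∑ x : X i.castSucc, ∑ x' : X i.succ,
    g i.succ x' (y i.succ) * f i x x' * bayesFilter f₀ f g y i.castSucc x
  rw [Finset.mul_sum]
  simp_rw [jointFilter_succ, Finset.mul_sum]
  rw [Finset.sum_comm]
  refine Finset.sum_congr rfl fun x _ => Finset.sum_congr rfl fun x' _ => ?_
  rw [jointFilter_eq_sum_mul_bayesFilter]
  ring

end DiscreteHMM
end

section
/- Define β_t by the backward recursion: β_n(x) := 1 for all x ∈ X_n, and for 0 ≤ t < n, β_t(y_{t+1}, …, y_n | x) := Σ_{x' ∈ X_{t+1}} g_{t+1}(y_{t+1} | x') · β_{t+1}(y_{t+2}, …, y_n | x') · f_{t+1}(x' | x). Then the backward algorithm is correct: for every 0 ≤ t ≤ n, every observation sequence y_{t+1}, …, y_n, and every x ∈ X_t with P_p(X_t = x) > 0, β_t(y_{t+1}, …, y_n | x) = P_p(Y_{t+1} = y_{t+1}, …, Y_n = y_n | X_t = x). -/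
open scoped ENNReal Classical

namespace DiscreteHMM

variable {n : ℕ}

variable {X Y : Fin (n+1) → Type*} [∀ i, Fintype (X i)] [∀ i, Fintype (Y i)]
  [∀ i, Nonempty (X i)] [∀ i, Nonempty (Y i)]

/-- The backward quantities `β_t`, defined by the backward recursion `β_n(x) = 1` and
`β_t(y_{t+1},…,y_n | x) = Σ_{x'} g_{t+1}(y_{t+1}|x') · β_{t+1}(y_{t+2},…,y_n|x') ·
f_{t+1}(x'|x)`. -/
noncomputable def backward (f : ∀ t : Fin n, X t.castSucc → PMF (X t.succ))
    (g : ∀ t : Fin (n+1), X t → PMF (Y t)) (y : ∀ t, Y t) :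
    ∀ t : Fin (n+1), X t → ℝ≥0∞ :=
  Fin.reverseInduction (fun _ => 1)
    (fun i ih x => ∑ x' : X i.succ, g i.succ x' (y i.succ) * ih x' * f i x x')

/-- Peeling off the initial time from a sum over trajectories. -/
lemma sum_trajectory_cons {m : ℕ} {Z : Fin (m+1) → Type*} [∀ i, Fintype (Z i)]
    (F : (∀ t, Z t) → ℝ≥0∞) :
    ∑ ω, F ω = ∑ z : Z 0, ∑ ω : ∀ t : Fin m, Z t.succ, F (Fin.cons z ω) := by
  rw [← (Fin.consEquiv Z).sum_comp, Fintype.sum_prod_type]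
  rfl

/-- The transition kernel out of the initial time. -/
noncomputable def firstTransition {n : ℕ} {X : Fin (n+1+1) → Type*}
    (f : ∀ t : Fin (n+1), X t.castSucc → PMF (X t.succ)) : X 0 → PMF (X (Fin.succ 0)) :=
  f 0

lemma hmmJoint_cons {n : ℕ} {X Y : Fin (n+1+1) → Type*}
    (f₀ : PMF (X 0)) (f : ∀ t : Fin (n+1), X t.castSucc → PMF (X t.succ))
    (g : ∀ t : Fin (n+1+1), X t → PMF (Y t)) (z : X 0 × Y 0)
    (ω : ∀ t : Fin (n+1), X t.succ × Y t.succ) :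
    hmmJoint f₀ f g (Fin.cons z ω : ∀ t, X t × Y t) =
      f₀ z.1 * g 0 z.1 z.2 *
        hmmJoint (X := fun t => X t.succ) (Y := fun t => Y t.succ) (firstTransition f z.1)
          (fun t => f t.succ) (fun t => g t.succ) ω := by
  rw [hmmJoint, hmmJoint, Fin.prod_univ_succ]
  rfl

/-- Conditioning on the initial hidden state and observation. -/
lemma prob_hmmJoint_succ {n : ℕ} {X Y : Fin (n+1+1) → Type*} [∀ i, Fintype (X i)]
    [∀ i, Fintype (Y i)]
    (f₀ : PMF (X 0)) (f : ∀ t : Fin (n+1), X t.castSucc → PMF (X t.succ))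
    (g : ∀ t : Fin (n+1+1), X t → PMF (Y t)) (E : Set (∀ t, X t × Y t)) :
    prob (hmmJoint f₀ f g) E =
      ∑ x, ∑ y, f₀ x * g 0 x y *
        prob (hmmJoint (X := fun t => X t.succ) (Y := fun t => Y t.succ)
          (firstTransition f x)
          (fun t => f t.succ) (fun t => g t.succ)) {ω | Fin.cons (x, y) ω ∈ E} := by
  unfold prob
  rw [sum_trajectory_cons, Fintype.sum_prod_type]
  refine Finset.sum_congr rfl fun x _ => Finset.sum_congr rfl fun y _ => ?_
  rw [Finset.mul_sum]
  refine Finset.sum_congr rfl fun ω _ => ?_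
  simp only [Set.indicator_apply, Set.mem_ofPred_eq, hmmJoint_cons, mul_ite, mul_zero]

lemma prob_hmmJoint_zero {X Y : Fin 1 → Type*} [∀ i, Fintype (X i)] [∀ i, Fintype (Y i)]
    (f₀ : PMF (X 0)) (f : ∀ t : Fin 0, X t.castSucc → PMF (X t.succ))
    (g : ∀ t : Fin 1, X t → PMF (Y t)) (E : Set (∀ t, X t × Y t)) :
    prob (hmmJoint f₀ f g) E =
      ∑ x, ∑ y, if Fin.cons (x, y) finZeroElim ∈ E then f₀ x * g 0 x y else 0 := by
  unfold prob
  rw [sum_trajectory_cons, Fintype.sum_prod_type]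
  refine Finset.sum_congr rfl fun x _ => Finset.sum_congr rfl fun y _ => ?_
  rw [Fintype.sum_unique, Set.indicator_apply]
  simp only [hmmJoint, Finset.univ_eq_empty, Finset.prod_empty, mul_one, Fin.cons_zero]
  congr!

lemma sum_pmf_eq_one {α : Type*} [Fintype α] (p : PMF α) : ∑ a, p a = 1 := by
  rw [← tsum_fintype (L := .unconditional α), p.tsum_coe]

lemma prob_hmmJoint_univ {n : ℕ} {X Y : Fin (n+1) → Type*} [∀ i, Fintype (X i)]
    [∀ i, Fintype (Y i)]
    (f₀ : PMF (X 0)) (f : ∀ t : Fin n, X t.castSucc → PMF (X t.succ))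
    (g : ∀ t : Fin (n+1), X t → PMF (Y t)) :
    prob (hmmJoint f₀ f g) Set.univ = 1 := by
  induction n with
  | zero =>
    rw [prob_hmmJoint_zero]
    simp [← Finset.mul_sum, sum_pmf_eq_one]
  | succ n ih =>
    rw [prob_hmmJoint_succ]
    simp [ih, ← Finset.mul_sum, sum_pmf_eq_one]

section Backward

variable {n : ℕ} {X Y : Fin (n+1) → Type*} [∀ i, Fintype (X i)]

lemma backward_last (f : ∀ t : Fin n, X t.castSucc → PMF (X t.succ))
    (g : ∀ t : Fin (n+1), X t → PMF (Y t)) (y : ∀ t, Y t) (x : X (Fin.last n)) :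
    backward f g y (Fin.last n) x = 1 := by
  simp [backward]

lemma backward_castSucc (f : ∀ t : Fin n, X t.castSucc → PMF (X t.succ))
    (g : ∀ t : Fin (n+1), X t → PMF (Y t)) (y : ∀ t, Y t) (i : Fin n) (x : X i.castSucc) :
    backward f g y i.castSucc x =
      ∑ x', g i.succ x' (y i.succ) * backward f g y i.succ x' * f i x x' := by
  simp [backward]

end Backward

lemma backward_succ {n : ℕ} {X Y : Fin (n+1+1) → Type*} [∀ i, Fintype (X i)]
    (f : ∀ t : Fin (n+1), X t.castSucc → PMF (X t.succ))
    (g : ∀ t : Fin (n+1+1), X t → PMF (Y t)) (y : ∀ t, Y t) (t : Fin (n+1)) (x : X t.succ) :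
    backward f g y t.succ x =
      backward (X := fun t => X t.succ) (Y := fun t => Y t.succ)
        (fun t => f t.succ) (fun t => g t.succ) (fun t => y t.succ) t x := by
  induction t using Fin.reverseInduction with
  | last => exact (backward_last f g y x).trans (backward_last _ _ _ _).symm
  | cast i ih =>
    rw [backward_castSucc]
    refine (backward_castSucc f g y i.succ x).trans ?_
    exact Finset.sum_congr rfl fun x' _ => by rw [ih]

lemma backward_zero {n : ℕ} {X Y : Fin (n+1+1) → Type*} [∀ i, Fintype (X i)]
    (f : ∀ t : Fin (n+1), X t.castSucc → PMF (X t.succ))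
    (g : ∀ t : Fin (n+1+1), X t → PMF (Y t)) (y : ∀ t, Y t) (x : X 0) :
    backward f g y 0 x =
      ∑ x', g (Fin.succ 0) x' (y (Fin.succ 0)) *
        backward (X := fun t => X t.succ) (Y := fun t => Y t.succ)
          (fun t => f t.succ) (fun t => g t.succ) (fun t => y t.succ) 0 x' *
        firstTransition f x x' := by
  simp only [← backward_succ]
  exact backward_castSucc f g y 0 x

/-- The likelihood of a full observation sequence, in terms of the backward quantities. -/
lemma prob_observations {n : ℕ} {X Y : Fin (n+1) → Type*} [∀ i, Fintype (X i)]
    [∀ i, Fintype (Y i)]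
    (f₀ : PMF (X 0)) (f : ∀ t : Fin n, X t.castSucc → PMF (X t.succ))
    (g : ∀ t : Fin (n+1), X t → PMF (Y t)) (y : ∀ t, Y t) :
    prob (hmmJoint f₀ f g) {ω | ∀ i, (ω i).2 = y i} =
      ∑ x, g 0 x (y 0) * backward f g y 0 x * f₀ x := by
  induction n with
  | zero =>
    rw [prob_hmmJoint_zero]
    refine Finset.sum_congr rfl fun x _ => ?_
    rw [show backward f g y 0 x = 1 from backward_last f g y x]
    simp [Fin.forall_fin_one, mul_comm]
  | succ n ih =>
    rw [prob_hmmJoint_succ]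
    refine Finset.sum_congr rfl fun x _ => ?_
    rw [Finset.sum_eq_single (y 0)]
    · have h : {ω : ∀ t : Fin (n+1), X t.succ × Y t.succ |
          (Fin.cons (x, y 0) ω : ∀ t, X t × Y t) ∈ {ω | ∀ i, (ω i).2 = y i}} =
          {ω | ∀ i, (ω i).2 = y i.succ} := by
        ext ω
        simp [Fin.forall_fin_succ (n := n+1)]
      rw [h, ih (X := fun t => X t.succ) (Y := fun t => Y t.succ) (firstTransition f x) _ _
        (fun t => y t.succ), ← backward_zero, mul_comm (f₀ x), mul_right_comm]
    · intro b _ hb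
      simp [prob, Fin.forall_fin_succ (n := n+1), hb]
    · simp

/-- The chain rule `P(Y_{t+1} = y_{t+1}, …, Y_n = y_n, X_t = x) = P(X_t = x) · β_t(x)`. -/
lemma prob_future_observations {n : ℕ} {X Y : Fin (n+1) → Type*} [∀ i, Fintype (X i)]
    [∀ i, Fintype (Y i)]
    (f₀ : PMF (X 0)) (f : ∀ t : Fin n, X t.castSucc → PMF (X t.succ))
    (g : ∀ t : Fin (n+1), X t → PMF (Y t)) (y : ∀ t, Y t) (t : Fin (n+1)) (x : X t) :
    prob (hmmJoint f₀ f g) {ω | (∀ i, t < i → (ω i).2 = y i) ∧ (ω t).1 = x} =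
      prob (hmmJoint f₀ f g) {ω | (ω t).1 = x} * backward f g y t x := by
  induction n with
  | zero =>
    obtain rfl : t = Fin.last 0 := Fin.fin_one_eq_zero t
    rw [backward_last, mul_one]
    congr! 2
    ext ω
    simp
  | succ n ih =>
    rw [prob_hmmJoint_succ, prob_hmmJoint_succ, Finset.sum_mul]
    refine Finset.sum_congr rfl fun x₀ _ => ?_
    rw [Finset.sum_mul]
    refine Finset.sum_congr rfl fun y₀ _ => ?_
    rw [mul_assoc (f₀ x₀ * g 0 x₀ y₀)]
    congr 1
    cases t using Fin.cases with
    | zero =>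
      simp only [Set.mem_ofPred_eq, Fin.forall_fin_succ (n := n+1), Fin.cons_zero, Fin.cons_succ,
        lt_self_iff_false, Fin.succ_pos, false_imp_iff, true_imp_iff, true_and]
      by_cases hx : x₀ = x
      · subst hx
        simp only [and_true, Set.ofPred_true]
        rw [prob_hmmJoint_univ, one_mul, backward_zero]
        exact prob_observations _ _ _ (fun t => y t.succ)
      · simp [prob, hx]
    | succ s =>
      rw [backward_succ]
      simpa [Fin.forall_fin_succ (n := n+1)] using
        ih (X := fun t => X t.succ) (Y := fun t => Y t.succ) (firstTransition f x₀) _ _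
          (fun t => y t.succ) s x

/-- **Correctness of the backward algorithm in `FinStoch`**: for every `t`, every
observation sequence and every hidden state `x` with `P(X_t = x) > 0`,
`β_t(y_{t+1},…,y_n | x) = P(Y_{t+1} = y_{t+1}, …, Y_n = y_n | X_t = x)`. -/
theorem backward_correct
    (f₀ : PMF (X 0)) (f : ∀ t : Fin n, X t.castSucc → PMF (X t.succ))
    (g : ∀ t : Fin (n+1), X t → PMF (Y t)) (y : ∀ t, Y t) :
    ∀ (t : Fin (n+1)) (x : X t),
      0 < prob (hmmJoint f₀ f g) {ω | (ω t).1 = x} →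
      backward f g y t x =
        prob (hmmJoint f₀ f g) {ω | (∀ i, t < i → (ω i).2 = y i) ∧ (ω t).1 = x} /
          prob (hmmJoint f₀ f g) {ω | (ω t).1 = x} := by
  intro t x hx
  have h_top : prob (hmmJoint f₀ f g) {ω | (ω t).1 = x} ≠ ∞ := by
    refine ne_top_of_le_ne_top ENNReal.one_ne_top ?_
    rw [← prob_hmmJoint_univ f₀ f g]
    exact Finset.sum_le_sum fun ω _ =>
      Set.indicator_le_indicator_of_subset (Set.subset_univ _) (fun _ => zero_le) ω
  rw [prob_future_observations, ENNReal.eq_div_iff hx.ne' h_top]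

end DiscreteHMM
end
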